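/- arXiv:1701.06982 — 12 statements merged into one kernel-verified Lean document; each statement's English description precedes it below -/
import Mathlib

section
/- The polynomial P has exactly three distinct roots in (0,∞) if and only if the conditions (GC) hold. Moreover, when (GC) holds, P additionally has exactly one root in (−∞,0). -/
/-- The quartic polynomial `P(r) = -Λ r⁴ + r² - 2 M r + Q²` (so that `r² f(r) = P(r)`). -/
noncomputable def Pquart (M Q Λ r : ℝ) : ℝ := -Λ * r ^ 4 + r ^ 2 - 2 * M * r + Q ^ 2

lemma aux_dd1 {M Q Λ a b : ℝ} (hab : a ≠ b) (ha : Pquart M Q Λ a = 0) (hb : Pquart M Q Λ b = 0) :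
    -Λ * (a ^ 3 + a ^ 2 * b + a * b ^ 2 + b ^ 3) + (a + b) - 2 * M = 0 := by
  unfold Pquart at ha hb
  apply mul_left_cancel₀ (sub_ne_zero.2 hab)
  linear_combination ha - hb

lemma aux_dd2 {M Q Λ a b c : ℝ} (hab : a ≠ b) (hac : a ≠ c) (hbc : b ≠ c)
    (ha : Pquart M Q Λ a = 0) (hb : Pquart M Q Λ b = 0) (hc : Pquart M Q Λ c = 0) :
    Λ * (a ^ 2 + b ^ 2 + c ^ 2 + a * b + b * c + c * a) = 1 := by
  have h1 := aux_dd1 hab ha hb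
  have h2 := aux_dd1 hac ha hc
  apply mul_left_cancel₀ (sub_ne_zero.2 hbc)
  linear_combination h2 - h1

lemma aux_dd3 {M Q Λ a b c d : ℝ} (hΛ : 0 < Λ) (hab : a ≠ b) (hac : a ≠ c) (hbc : b ≠ c)
    (had : a ≠ d) (hbd : b ≠ d) (hcd : c ≠ d)
    (ha : Pquart M Q Λ a = 0) (hb : Pquart M Q Λ b = 0) (hc : Pquart M Q Λ c = 0)
    (hd : Pquart M Q Λ d = 0) : a + b + c + d = 0 := by
  have h1 := aux_dd2 hab hac hbc ha hb hc
  have h2 := aux_dd2 hab had hbd ha hb hd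
  apply mul_left_cancel₀ (mul_ne_zero hΛ.ne' (sub_ne_zero.2 hcd))
  linear_combination h1 - h2

lemma aux_four {M Q Λ a b c d : ℝ} (hΛ : 0 < Λ) (hab : a < b) (hbc : b < c) (hcd : c < d)
    (ha : Pquart M Q Λ a = 0) (hb : Pquart M Q Λ b = 0) (hc : Pquart M Q Λ c = 0)
    (hd : Pquart M Q Λ d = 0) (e : ℝ) (he : Pquart M Q Λ e = 0) :
    e = a ∨ e = b ∨ e = c ∨ e = d := by
  by_contra! h
  obtain ⟨h1, h2, h3, h4⟩ := h
  have k1 := aux_dd3 hΛ hab.ne (hab.trans hbc).ne hbc.ne (by linarith : a < d).ne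
    (by linarith : b < d).ne hcd.ne ha hb hc hd
  have k2 := aux_dd3 hΛ hab.ne (hab.trans hbc).ne hbc.ne h1.symm h2.symm h3.symm ha hb hc he
  exact h4 (by linarith)

lemma aux_cont (M Q Λ : ℝ) : Continuous (Pquart M Q Λ) := by
  unfold Pquart; fun_prop

lemma aux_up {M Q Λ x y : ℝ} (hxy : x < y) (hx : Pquart M Q Λ x < 0) (hy : 0 < Pquart M Q Λ y) :
    ∃ r, x < r ∧ r < y ∧ Pquart M Q Λ r = 0 := by
  obtain ⟨r, hr, h⟩ := intermediate_value_Ioo hxy.le (aux_cont M Q Λ).continuousOn ⟨hx, hy⟩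
  exact ⟨r, hr.1, hr.2, h⟩

lemma aux_down {M Q Λ x y : ℝ} (hxy : x < y) (hx : 0 < Pquart M Q Λ x) (hy : Pquart M Q Λ y < 0) :
    ∃ r, x < r ∧ r < y ∧ Pquart M Q Λ r = 0 := by
  obtain ⟨r, hr, h⟩ := intermediate_value_Ioo' hxy.le (aux_cont M Q Λ).continuousOn ⟨hy, hx⟩
  exact ⟨r, hr.1, hr.2, h⟩

lemma aux_large {M Q Λ : ℝ} (hM : 0 < M) (hΛ : 0 < Λ) (B : ℝ) :
    ∃ K, B < K ∧ 0 < K ∧ Pquart M Q Λ K < 0 ∧ Pquart M Q Λ (-K) < 0 := by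
  set K := 1 + |B| + (1 + 2 * M + Q ^ 2) / Λ with hK
  have h0 : 0 < (1 + 2 * M + Q ^ 2) / Λ := by positivity
  have hB := le_abs_self B
  have hB' := abs_nonneg B
  have hK1 : 1 ≤ K := by linarith
  have h1 : 1 + 2 * M + Q ^ 2 < Λ * K := by
    have : Λ * K = Λ * (1 + |B|) + (1 + 2 * M + Q ^ 2) := by rw [hK]; field_simp
    rw [this]
    have : 0 < Λ * (1 + |B|) := by positivity
    linarith
  have hK2 : K ≤ K ^ 2 := by nlinarith
  have hK3 : K ^ 2 ≤ K ^ 3 := by nlinarith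
  have h2 : (1 + 2 * M + Q ^ 2) * K ^ 3 < Λ * K * K ^ 3 := by
    apply mul_lt_mul_of_pos_right h1; positivity
  have h3 : 2 * M * K ≤ 2 * M * K ^ 3 := by
    apply mul_le_mul_of_nonneg_left _ (by positivity); linarith
  have h4 : Q ^ 2 * 1 ≤ Q ^ 2 * K ^ 3 := by
    apply mul_le_mul_of_nonneg_left _ (by positivity); linarith
  have h5 : 0 < 2 * M * K := by positivity
  refine ⟨K, by linarith, by linarith, ?_, ?_⟩ <;> unfold Pquart <;> nlinarith

/-- facts about critical radii -/
lemma aux_crit {Q Λ R Δ m₁ m₂ : ℝ} (hΛ : 0 < Λ) (hQ : Q ≠ 0)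
    (hR : R = 1 / Real.sqrt (6 * Λ))
    (hΔ : Δ = 1 - 12 * Q ^ 2 * Λ)
    (hm₁ : m₁ = R * Real.sqrt (1 - Real.sqrt Δ))
    (hm₂ : m₂ = R * Real.sqrt (1 + Real.sqrt Δ)) (h : 0 < Δ) :
    0 < m₁ ∧ m₁ < m₂ ∧ 3 * Λ * (m₁ ^ 2 + m₂ ^ 2) = 1 ∧ Q ^ 2 = 3 * Λ * m₁ ^ 2 * m₂ ^ 2 := by
  have hQ2 : 0 < Q ^ 2 := by positivity
  have hs0 : 0 < Real.sqrt Δ := Real.sqrt_pos.2 h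
  have hss : Real.sqrt Δ ^ 2 = Δ := Real.sq_sqrt h.le
  have hs1 : Real.sqrt Δ < 1 := by
    have : 0 < Q ^ 2 * Λ := by positivity
    nlinarith
  have hRp : 0 < R := by rw [hR]; positivity
  have hR2 : 6 * Λ * R ^ 2 = 1 := by
    rw [hR, div_pow, Real.sq_sqrt (by positivity)]; field_simp
  have e1 : m₁ ^ 2 = R ^ 2 * (1 - Real.sqrt Δ) := by
    rw [hm₁, mul_pow, Real.sq_sqrt (by linarith)]
  have e2 : m₂ ^ 2 = R ^ 2 * (1 + Real.sqrt Δ) := by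
    rw [hm₂, mul_pow, Real.sq_sqrt (by linarith)]
  refine ⟨?_, ?_, ?_, ?_⟩
  · rw [hm₁]; exact mul_pos hRp (Real.sqrt_pos.2 (by linarith))
  · rw [hm₁, hm₂]
    exact mul_lt_mul_of_pos_left (Real.sqrt_lt_sqrt (by linarith) (by linarith)) hRp
  · rw [e1, e2]; linear_combination hR2
  · rw [mul_assoc, e1, e2]
    apply mul_left_cancel₀ (by positivity : (12 * Λ) ≠ 0)
    linear_combination hΔ + hss + (6 * Λ * R ^ 2 + 1) * (Real.sqrt Δ ^ 2 - 1) * hR2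

lemma aux_mono {M Q Λ x y m n : ℝ} (hΛ : 0 < Λ) (hx : 0 < x) (hxy : x < y)
    (h1 : 3 * Λ * (m ^ 2 + n ^ 2) = 1) (h2 : Q ^ 2 = 3 * Λ * m ^ 2 * n ^ 2)
    (hs : 0 ≤ (x * y - m ^ 2) * (m ^ 2 - n ^ 2))
    (hPx : Pquart M Q Λ x = 0) (hPy : Pquart M Q Λ y = 0) : False := by
  have key : x * y - Λ * (x * y) * (x ^ 2 + x * y + y ^ 2) - Q ^ 2 = 0 := by
    unfold Pquart at hPx hPy
    apply mul_left_cancel₀ (sub_ne_zero.2 hxy.ne)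
    linear_combination y * hPx - x * hPy
  have k2 : 3 * (x * y) * (m ^ 2 + n ^ 2) - (x * y) * (x ^ 2 + x * y + y ^ 2)
      - 3 * m ^ 2 * n ^ 2 = 0 := by
    apply mul_left_cancel₀ hΛ.ne'
    linear_combination key + x * y * h1 + h2
  have h3 : 0 < (x * y) * (x - y) ^ 2 := by
    have : x - y ≠ 0 := sub_ne_zero.2 hxy.ne
    have := hx.trans hxy
    positivity
  nlinarith [sq_nonneg (x * y - m ^ 2)]

lemma aux_fac {M Q Λ m n : ℝ}
    (h1 : 3 * Λ * (m ^ 2 + n ^ 2) = 1) (h2 : Q ^ 2 = 3 * Λ * m ^ 2 * n ^ 2) (r : ℝ) :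
    Pquart M Q Λ r = -Λ * (r - m) ^ 2 * (r ^ 2 + 2 * m * r - 3 * n ^ 2)
      + 2 * r * ((m - 2 * Λ * m ^ 3) - M) := by
  unfold Pquart
  linear_combination h2 - (r ^ 2 - 2 * m * r) * h1

/-- `P` has exactly three distinct roots in `(0,∞)` iff the conditions (GC)
hold; moreover, under (GC), `P` has exactly one root in `(-∞,0)`. -/
theorem stmt_0 (M Q Λ : ℝ) (hM : 0 < M) (hΛ : 0 < Λ) (hQ : Q ≠ 0)
    (R Δ m₁ m₂ M₁ M₂ : ℝ)
    (hR : R = 1 / Real.sqrt (6 * Λ))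
    (hΔ : Δ = 1 - 12 * Q ^ 2 * Λ)
    (hm₁ : m₁ = R * Real.sqrt (1 - Real.sqrt Δ))
    (hm₂ : m₂ = R * Real.sqrt (1 + Real.sqrt Δ))
    (hM₁ : M₁ = m₁ - 2 * Λ * m₁ ^ 3)
    (hM₂ : M₂ = m₂ - 2 * Λ * m₂ ^ 3) :
    ((∃ r₁ r₂ r₃ : ℝ, 0 < r₁ ∧ r₁ < r₂ ∧ r₂ < r₃ ∧
        {r : ℝ | 0 < r ∧ Pquart M Q Λ r = 0} = {r₁, r₂, r₃}) ↔
      (Q ≠ 0 ∧ 0 < Λ ∧ Λ < 1 / (12 * Q ^ 2) ∧ M₁ < M ∧ M < M₂)) ∧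
    ((Q ≠ 0 ∧ 0 < Λ ∧ Λ < 1 / (12 * Q ^ 2) ∧ M₁ < M ∧ M < M₂) →
      ∃! r : ℝ, r < 0 ∧ Pquart M Q Λ r = 0) := by
  have hQ2 : 0 < Q ^ 2 := by positivity
  have hGC : Λ < 1 / (12 * Q ^ 2) ↔ 0 < Δ := by
    rw [lt_div_iff₀ (by positivity), hΔ]
    constructor <;> intro h <;> linarith
  have main : (Q ≠ 0 ∧ 0 < Λ ∧ Λ < 1 / (12 * Q ^ 2) ∧ M₁ < M ∧ M < M₂) →
      ∃ r₀ r₁ r₂ r₃ : ℝ, r₀ < 0 ∧ 0 < r₁ ∧ r₁ < r₂ ∧ r₂ < r₃ ∧ Pquart M Q Λ r₀ = 0 ∧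
        Pquart M Q Λ r₁ = 0 ∧ Pquart M Q Λ r₂ = 0 ∧ Pquart M Q Λ r₃ = 0 := by
    rintro ⟨-, -, h, hl, hu⟩
    obtain ⟨p1, p2, e1, e2⟩ := aux_crit hΛ hQ hR hΔ hm₁ hm₂ (hGC.1 h)
    have f1 := aux_fac (M := M) e1 e2 m₁
    have f2 := aux_fac (M := M) (Q := Q) (Λ := Λ) (m := m₂) (n := m₁) (by linarith) (by linarith) m₂
    rw [← hM₁] at f1
    rw [← hM₂] at f2
    have g0 : 0 < Pquart M Q Λ 0 := by simp [Pquart]; positivity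
    have g1 : Pquart M Q Λ m₁ < 0 := by
      have : 0 < 2 * m₁ * (M - M₁) := mul_pos (by linarith) (by linarith)
      rw [f1]; linarith
    have g2 : 0 < Pquart M Q Λ m₂ := by
      have : 0 < 2 * m₂ * (M₂ - M) := mul_pos (by linarith) (by linarith)
      rw [f2]; linarith
    obtain ⟨K, hK, hK0, g3, g4⟩ := aux_large (Q := Q) hM hΛ m₂
    obtain ⟨r₀, a0, b0, c0⟩ := aux_up (by linarith : -K < 0) g4 g0
    obtain ⟨r₁, a1, b1, c1⟩ := aux_down p1 g0 g1
    obtain ⟨r₂, a2, b2, c2⟩ := aux_up p2 g1 g2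
    obtain ⟨r₃, a3, b3, c3⟩ := aux_down hK g2 g3
    exact ⟨r₀, r₁, r₂, r₃, b0, a1, by linarith, by linarith, c0, c1, c2, c3⟩
  refine ⟨⟨?_, ?_⟩, ?_⟩
  · rintro ⟨a, b, c, ha, hab, hbc, hS⟩
    have hPa : Pquart M Q Λ a = 0 := by
      have : a ∈ {r : ℝ | 0 < r ∧ Pquart M Q Λ r = 0} := by rw [hS]; simp
      exact this.2
    have hPb : Pquart M Q Λ b = 0 := by
      have : b ∈ {r : ℝ | 0 < r ∧ Pquart M Q Λ r = 0} := by rw [hS]; simp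
      exact this.2
    have hPc : Pquart M Q Λ c = 0 := by
      have : c ∈ {r : ℝ | 0 < r ∧ Pquart M Q Λ r = 0} := by rw [hS]; simp
      exact this.2
    have hb := ha.trans hab
    have hc := hb.trans hbc
    have d1 := aux_dd1 hab.ne hPa hPb
    have d2 := aux_dd2 hab.ne (hab.trans hbc).ne hbc.ne hPa hPb hPc
    have hQe : Q ^ 2 = Λ * (a * b * c * (a + b + c)) := by
      unfold Pquart at hPa
      linear_combination hPa - a * d1 - a * b * d2
    have hD : 0 < Δ := by
      have e : Δ = Λ ^ 2 * ((a ^ 2 + b ^ 2 + c ^ 2 + a * b + b * c + c * a) ^ 2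
          - 12 * (a * b * c * (a + b + c))) := by
        rw [hΔ, hQe]
        linear_combination -(Λ * (a ^ 2 + b ^ 2 + c ^ 2 + a * b + b * c + c * a) + 1) * d2
      rw [e]
      apply mul_pos (by positivity)
      have s1 : 0 < (a - b) ^ 2 + (b - c) ^ 2 + (c - a) ^ 2 := by
        have : 0 < (b - a) ^ 2 := pow_pos (by linarith) 2
        nlinarith [sq_nonneg (b - c), sq_nonneg (c - a)]
      have s2 : 0 < a * b + b * c + c * a := by positivity
      have s3 : 2 * (a * b + b * c + c * a) < a ^ 2 + b ^ 2 + c ^ 2 + a * b + b * c + c * a := by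
        linarith
      have s4 : (2 * (a * b + b * c + c * a)) ^ 2 <
          (a ^ 2 + b ^ 2 + c ^ 2 + a * b + b * c + c * a) ^ 2 :=
        pow_lt_pow_left₀ s3 (by positivity) (by norm_num)
      nlinarith [sq_nonneg (a * b - b * c), sq_nonneg (b * c - c * a), sq_nonneg (c * a - a * b)]
    obtain ⟨p1, p2, e1, e2⟩ := aux_crit hΛ hQ hR hΔ hm₁ hm₂ hD
    have e1' : 3 * Λ * (m₂ ^ 2 + m₁ ^ 2) = 1 := by linarith
    have e2' : Q ^ 2 = 3 * Λ * m₂ ^ 2 * m₁ ^ 2 := by linarith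
    have sq12 : m₁ ^ 2 < m₂ ^ 2 := pow_lt_pow_left₀ p2 p1.le (by norm_num)
    have hb1 : m₁ < b := by
      by_contra! h
      refine aux_mono hΛ ha hab e1 e2 ?_ hPa hPb
      apply mul_nonneg_of_nonpos_of_nonpos _ (by linarith)
      have := mul_le_mul (hab.le.trans h) h hb.le p1.le
      linarith [pow_two m₁]
    have hb2 : b < m₂ := by
      by_contra! h
      refine aux_mono hΛ hb hbc e1' e2' ?_ hPb hPc
      apply mul_nonneg _ (by linarith)
      have := mul_le_mul h (h.trans hbc.le) (p1.trans p2).le hb.le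
      linarith [pow_two m₂]
    have q1 := mul_lt_mul'' hb2 hb2 hb.le hb.le
    have q2 := mul_lt_mul'' p2 hb2 p1.le hb.le
    have q3 := mul_lt_mul'' hb1 hb1 p1.le p1.le
    have q4 := mul_lt_mul'' p2 hb1 p1.le p1.le
    have f1 := aux_fac (M := M) e1 e2 b
    have f2 := aux_fac (M := M) e1' e2' b
    rw [hPb, ← hM₁] at f1
    rw [hPb, ← hM₂] at f2
    refine ⟨hQ, hΛ, hGC.2 hD, ?_, ?_⟩
    · have t : 0 < Λ * (b - m₁) ^ 2 * (3 * m₂ ^ 2 - (b ^ 2 + 2 * m₁ * b)) := by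
        have : 0 < b - m₁ := by linarith
        apply mul_pos (by positivity); linarith [pow_two b, pow_two m₁, pow_two m₂]
      have : 0 < 2 * b * (M - M₁) := by linarith
      have := (mul_pos_iff_of_pos_left (by linarith : 0 < 2 * b)).1 this
      linarith
    · have t : 0 < Λ * (b - m₂) ^ 2 * (b ^ 2 + 2 * m₂ * b - 3 * m₁ ^ 2) := by
        have : b - m₂ ≠ 0 := by intro h; linarith
        apply mul_pos (by positivity); linarith [pow_two b, pow_two m₁, pow_two m₂]
      have : 0 < 2 * b * (M₂ - M) := by linarith
      have := (mul_pos_iff_of_pos_left (by linarith : 0 < 2 * b)).1 this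
      linarith
  · intro h
    obtain ⟨r₀, r₁, r₂, r₃, h0, h1, h2, h3, c0, c1, c2, c3⟩ := main h
    refine ⟨r₁, r₂, r₃, h1, h2, h3, ?_⟩
    ext r
    simp only [Set.mem_setOf_eq, Set.mem_insert_iff, Set.mem_singleton_iff]
    constructor
    · rintro ⟨hr, hP⟩
      rcases aux_four hΛ (h0.trans h1) h2 h3 c0 c1 c2 c3 r hP with e | e
      · linarith
      · exact e
    · rintro (rfl | rfl | rfl)
      · exact ⟨h1, c1⟩
      · exact ⟨by linarith, c2⟩
      · exact ⟨by linarith, c3⟩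
  · intro h
    obtain ⟨r₀, r₁, r₂, r₃, h0, h1, h2, h3, c0, c1, c2, c3⟩ := main h
    refine ⟨r₀, ⟨h0, c0⟩, ?_⟩
    rintro r ⟨hr, hP⟩
    rcases aux_four hΛ (h0.trans h1) h2 h3 c0 c1 c2 c3 r hP with e | e | e | e
    · exact e
    all_goals linarith
end

section
/- Assume the conditions (GC) hold, and let 0 < r₁ < r₂ < r₃ be the three positive roots of P. Then 9M² − 8Q² > 0, and the set of r > 0 satisfying r·f'(r) − 2f(r) = 0 is exactly {P₁, P₂}, where P₁ = (3M − √(9M² − 8Q²))/2 and P₂ = (3M + √(9M² − 8Q²))/2. Moreover these zeros interlace the horizons as r₁ < P₁ < r₂ < P₂ < r₃; in particular exactly one zero of r·f'(r) − 2f(r) lies in the exterior static region (r₂, r₃), namely P₂ (the photon sphere radius). -/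
/-- The horizon function `f(r) = 1 - 2M/r + Q²/r² - Λ r²`. -/
noncomputable def horizonF (M Q Λ r : ℝ) : ℝ := 1 - 2 * M / r + Q ^ 2 / r ^ 2 - Λ * r ^ 2

/-- Under (GC), with `0 < r₁ < r₂ < r₃` the three positive roots of `P`,
one has `9M² - 8Q² > 0`, the set of positive zeros of `r f'(r) - 2 f(r)` is exactly
`{P₁, P₂}`, and the interlacing `r₁ < P₁ < r₂ < P₂ < r₃` holds. -/
theorem stmt_1 (M Q Λ : ℝ) (hM : 0 < M) (hΛ : 0 < Λ) (hQ : Q ≠ 0)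
    (R Δ m₁ m₂ M₁ M₂ : ℝ)
    (hR : R = 1 / Real.sqrt (6 * Λ))
    (hΔ : Δ = 1 - 12 * Q ^ 2 * Λ)
    (hm₁ : m₁ = R * Real.sqrt (1 - Real.sqrt Δ))
    (hm₂ : m₂ = R * Real.sqrt (1 + Real.sqrt Δ))
    (hM₁ : M₁ = m₁ - 2 * Λ * m₁ ^ 3)
    (hM₂ : M₂ = m₂ - 2 * Λ * m₂ ^ 3)
    (hGC : Q ≠ 0 ∧ 0 < Λ ∧ Λ < 1 / (12 * Q ^ 2) ∧ M₁ < M ∧ M < M₂)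
    (r₁ r₂ r₃ : ℝ) (h₁ : 0 < r₁) (h₁₂ : r₁ < r₂) (h₂₃ : r₂ < r₃)
    (hroots : {r : ℝ | 0 < r ∧ Pquart M Q Λ r = 0} = {r₁, r₂, r₃})
    (P₁ P₂ : ℝ)
    (hP₁ : P₁ = (3 * M - Real.sqrt (9 * M ^ 2 - 8 * Q ^ 2)) / 2)
    (hP₂ : P₂ = (3 * M + Real.sqrt (9 * M ^ 2 - 8 * Q ^ 2)) / 2) :
    9 * M ^ 2 - 8 * Q ^ 2 > 0 ∧
    {r : ℝ | 0 < r ∧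
        r * deriv (horizonF M Q Λ) r - 2 * horizonF M Q Λ r = 0} = {P₁, P₂} ∧
    r₁ < P₁ ∧ P₁ < r₂ ∧ r₂ < P₂ ∧ P₂ < r₃ := by
  clear hGC hm₁ hm₂ hM₁ hM₂ hR hΔ
  have hr : ∀ r, r = r₁ ∨ r = r₂ ∨ r = r₃ → Pquart M Q Λ r = 0 := by
    intro r h
    have : r ∈ {r : ℝ | 0 < r ∧ Pquart M Q Λ r = 0} := by
      rw [hroots]; simpa using h
    exact this.2
  have e1 := hr r₁ (by simp)
  have e2 := hr r₂ (by simp)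
  have e3 := hr r₃ (by simp)
  simp only [Pquart] at e1 e2 e3
  have k12 : -Λ * (r₁ + r₂) * (r₁ ^ 2 + r₂ ^ 2) + (r₁ + r₂) - 2 * M = 0 := by
    have : r₁ - r₂ ≠ 0 := by intro h; linarith
    apply mul_left_cancel₀ this
    linear_combination e1 - e2
  have k23 : -Λ * (r₂ + r₃) * (r₂ ^ 2 + r₃ ^ 2) + (r₂ + r₃) - 2 * M = 0 := by
    have : r₂ - r₃ ≠ 0 := by intro h; linarith
    apply mul_left_cancel₀ this
    linear_combination e2 - e3
  have kk : 1 - Λ * (r₁ ^ 2 + r₂ ^ 2 + r₃ ^ 2 + r₁ * r₂ + r₂ * r₃ + r₁ * r₃) = 0 := by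
    have : r₁ - r₃ ≠ 0 := by intro h; linarith
    apply mul_left_cancel₀ this
    linear_combination k12 - k23
  have key : ∀ a b c : ℝ, -Λ * a ^ 4 + a ^ 2 - 2 * M * a + Q ^ 2 = 0 →
      -Λ * (a + b) * (a ^ 2 + b ^ 2) + (a + b) - 2 * M = 0 →
      1 - Λ * (a ^ 2 + b ^ 2 + c ^ 2 + a * b + b * c + a * c) = 0 →
      a ^ 2 - 3 * M * a + 2 * Q ^ 2 = a * Λ * (a - b) * (a - c) * (2 * a + b + c) / 2 := by
    intro a b c h1 h2 h3
    linear_combination 2 * h1 - a / 2 * h2 - a * (a - b) / 2 * h3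
  have g1 : 0 < r₁ ^ 2 - 3 * M * r₁ + 2 * Q ^ 2 := by
    rw [key r₁ r₂ r₃ e1 k12 kk]
    have : 0 < r₁ * Λ * (r₂ - r₁) * (r₃ - r₁) * (2 * r₁ + r₂ + r₃) :=
      mul_pos (mul_pos (mul_pos (mul_pos h₁ hΛ) (by linarith)) (by linarith)) (by linarith)
    linarith
  have g2 : r₂ ^ 2 - 3 * M * r₂ + 2 * Q ^ 2 < 0 := by
    rw [key r₂ r₃ r₁ e2 k23 (by linarith)]
    have : 0 < r₂ * Λ * (r₃ - r₂) * (r₂ - r₁) * (2 * r₂ + r₃ + r₁) :=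
      mul_pos (mul_pos (mul_pos (mul_pos (by linarith) hΛ) (by linarith)) (by linarith))
        (by linarith)
    linarith
  have g3 : 0 < r₃ ^ 2 - 3 * M * r₃ + 2 * Q ^ 2 := by
    rw [key r₃ r₂ r₁ e3 (by linarith) (by linarith)]
    have : 0 < r₃ * Λ * (r₃ - r₂) * (r₃ - r₁) * (2 * r₃ + r₂ + r₁) :=
      mul_pos (mul_pos (mul_pos (mul_pos (by linarith) hΛ) (by linarith)) (by linarith))
        (by linarith)
    linarith
  have hd : 0 < 9 * M ^ 2 - 8 * Q ^ 2 := by nlinarith [sq_nonneg (2 * r₂ - 3 * M)]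
  have hs := Real.sq_sqrt hd.le
  have hs0 := Real.sqrt_pos.2 hd
  set s := Real.sqrt (9 * M ^ 2 - 8 * Q ^ 2) with hsdef
  have hQ2 : 0 < Q ^ 2 := by positivity
  have hfac : ∀ r, r ^ 2 - 3 * M * r + 2 * Q ^ 2 = (r - P₁) * (r - P₂) := by
    intro r
    rw [hP₁, hP₂]
    linear_combination (1 / 4 : ℝ) * hs
  have h12 : P₁ < P₂ := by rw [hP₁, hP₂]; linarith
  have hpos : 0 < P₁ := by
    have : s < 3 * M := by nlinarith
    rw [hP₁]; linarith
  rw [hfac] at g1 g2 g3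
  have i1 : P₁ < r₂ := by
    by_contra h
    nlinarith [mul_nonneg (sub_nonneg.2 (not_lt.1 h)) (show 0 ≤ P₂ - r₂ by linarith)]
  have i2 : r₂ < P₂ := by
    by_contra h
    nlinarith [mul_nonneg (sub_nonneg.2 i1.le) (sub_nonneg.2 (not_lt.1 h))]
  refine ⟨hd, ?_, ?_, i1, i2, ?_⟩
  · ext r
    simp only [Set.mem_ofPred_eq, Set.mem_insert_iff, Set.mem_singleton_iff]
    have main : 0 < r → (r * deriv (horizonF M Q Λ) r - 2 * horizonF M Q Λ r) * r ^ 2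
        = -2 * ((r - P₁) * (r - P₂)) := by
      intro hr0
      have hne : r ≠ 0 := hr0.ne'
      have hder : HasDerivAt (horizonF M Q Λ)
          (0 - (0 * r - 2 * M * 1) / r ^ 2 + (0 * r ^ 2 - Q ^ 2 * (2 * r)) / (r ^ 2) ^ 2
            - Λ * (2 * r)) r := by
        have hsq : HasDerivAt (fun x : ℝ => x ^ 2) (2 * r) r := by
          simpa using hasDerivAt_pow 2 r
        exact (((hasDerivAt_const r (1 : ℝ)).sub
          ((hasDerivAt_const r (2 * M)).div (hasDerivAt_id r) hne)).add
          ((hasDerivAt_const r (Q ^ 2)).div hsq (pow_ne_zero 2 hne))).sub (hsq.const_mul Λ)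
      rw [hder.deriv, ← hfac]
      simp only [horizonF]
      field_simp
      ring
    constructor
    · rintro ⟨h0, h⟩
      have := main h0
      rw [h, zero_mul] at this
      have h' : (r - P₁) * (r - P₂) = 0 := by linarith
      rcases mul_eq_zero.1 h' with h | h
      · left; linarith
      · right; linarith
    · intro h
      have h0 : 0 < r := by rcases h with h | h <;> linarith
      refine ⟨h0, ?_⟩
      have hm := main h0
      have hz : (r - P₁) * (r - P₂) = 0 := by rcases h with h | h <;> simp [h]
      rw [hz, mul_zero] at hm
      exact (mul_eq_zero.1 hm).resolve_right (by positivity)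
  · by_contra h
    nlinarith [mul_nonneg (sub_nonneg.2 (not_lt.1 h)) (show 0 ≤ P₂ - r₁ by linarith)]
  · by_contra h
    nlinarith [mul_nonneg (sub_nonneg.2 (not_lt.1 h)) (show 0 ≤ r₃ - P₁ by linarith)]
end

section
/- The polynomial P has three distinct positive roots if and only if the following hold: P'(R) > 0, and, denoting by s₁ < s₂ the two positive roots of P' (which exist when P'(R) > 0), P(s₁) < 0 and P(s₂) > 0. -/
/-- Its derivative `P'(r) = -4 Λ r³ + 2 r - 2 M`. -/
noncomputable def Pquart' (M Λ r : ℝ) : ℝ := -4 * Λ * r ^ 3 + 2 * r - 2 * M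

/-- `P` has three distinct positive roots iff `P'(R) > 0` and, `s₁ < s₂`
denoting the two positive roots of `P'` (which exist when `P'(R) > 0`), `P(s₁) < 0` and
`P(s₂) > 0`. -/
theorem stmt_2 (M Q Λ : ℝ) (hM : 0 < M) (hΛ : 0 < Λ) (hQ : Q ≠ 0)
    (R : ℝ) (hR : R = 1 / Real.sqrt (6 * Λ)) :
    (∃ r₁ r₂ r₃ : ℝ, 0 < r₁ ∧ r₁ < r₂ ∧ r₂ < r₃ ∧
        Pquart M Q Λ r₁ = 0 ∧ Pquart M Q Λ r₂ = 0 ∧ Pquart M Q Λ r₃ = 0) ↔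
      (Pquart' M Λ R > 0 ∧
        ∃ s₁ s₂ : ℝ, 0 < s₁ ∧ s₁ < s₂ ∧ Pquart' M Λ s₁ = 0 ∧ Pquart' M Λ s₂ = 0 ∧
          Pquart M Q Λ s₁ < 0 ∧ Pquart M Q Λ s₂ > 0) := by
  have hR0 : 0 < R := by rw [hR]; positivity
  have hR2 : 6 * Λ * R ^ 2 = 1 := by
    have h6 : (0:ℝ) ≤ 6 * Λ := by positivity
    rw [hR, div_pow, Real.sq_sqrt h6]; field_simp
  have hcont : Continuous (Pquart M Q Λ) := by unfold Pquart; fun_prop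
  have hder : ∀ x, HasDerivAt (Pquart M Q Λ) (Pquart' M Λ x) x := by
    intro x
    have h := ((((hasDerivAt_id x).pow 4).const_mul (-Λ)).add ((hasDerivAt_id x).pow 2)).sub
      ((hasDerivAt_id x).const_mul (2 * M)) |>.add_const (Q ^ 2)
    refine h.congr_deriv ?_
    simp [Pquart']; ring
  have hdiff : ∀ x s, Pquart' M Λ s = 0 → Pquart M Q Λ x - Pquart M Q Λ s =
      (x - s) ^ 2 * (1 - Λ * (x ^ 2 + 2 * s * x + 3 * s ^ 2)) := by
    intro x s h
    unfold Pquart' at h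
    unfold Pquart
    linear_combination (x - s) * h
  constructor
  · rintro ⟨r₁, r₂, r₃, h1, h12, h23, e1, e2, e3⟩
    obtain ⟨s₁, ⟨a1, b1⟩, d1⟩ := exists_hasDerivAt_eq_zero h12 hcont.continuousOn
      (e1.trans e2.symm) (fun x _ => hder x)
    obtain ⟨s₂, ⟨a2, b2⟩, d2⟩ := exists_hasDerivAt_eq_zero h23 hcont.continuousOn
      (e2.trans e3.symm) (fun x _ => hder x)
    have hs1 : 0 < s₁ := by linarith
    have hs : s₁ < s₂ := by linarith
    have key : 2 * Λ * (s₁ ^ 2 + s₁ * s₂ + s₂ ^ 2) = 1 := by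
      have hne : s₂ - s₁ ≠ 0 := by linarith
      apply mul_left_cancel₀ hne
      unfold Pquart' at d1 d2
      linear_combination (d1 - d2) / 2
    have k1 : 6 * Λ * s₁ ^ 2 < 1 := by
      have : s₁ ^ 2 * 3 < s₁ ^ 2 + s₁ * s₂ + s₂ ^ 2 := by nlinarith
      nlinarith
    have k2 : 1 < 6 * Λ * s₂ ^ 2 := by
      have : s₁ ^ 2 + s₁ * s₂ + s₂ ^ 2 < s₂ ^ 2 * 3 := by nlinarith
      nlinarith
    refine ⟨?_, s₁, s₂, hs1, hs, d1, d2, ?_, ?_⟩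
    · have hne : R - s₁ ≠ 0 := by
        intro h
        have : R = s₁ := by linarith
        rw [this] at hR2; linarith
      have e : Pquart' M Λ R = 4 * Λ * (R - s₁) ^ 2 * (2 * R + s₁) := by
        unfold Pquart' at d1 ⊢
        linear_combination d1 - 2 * (R - s₁) * hR2
      rw [e]; positivity
    · have h := hdiff r₁ s₁ d1
      have hne : 0 < (r₁ - s₁) ^ 2 := by nlinarith
      have : r₁ ^ 2 + 2 * s₁ * r₁ + 3 * s₁ ^ 2 < 6 * s₁ ^ 2 := by nlinarith
      have h3 : 0 < 1 - Λ * (r₁ ^ 2 + 2 * s₁ * r₁ + 3 * s₁ ^ 2) := by nlinarith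
      have := mul_pos hne h3
      linarith
    · have h := hdiff r₃ s₂ d2
      have hne : 0 < (r₃ - s₂) ^ 2 := by nlinarith
      have : 6 * s₂ ^ 2 < r₃ ^ 2 + 2 * s₂ * r₃ + 3 * s₂ ^ 2 := by nlinarith
      have h3 : 1 - Λ * (r₃ ^ 2 + 2 * s₂ * r₃ + 3 * s₂ ^ 2) < 0 := by nlinarith
      have := mul_neg_of_pos_of_neg hne h3
      show 0 < _
      linarith
  · rintro ⟨-, s₁, s₂, hs1, hs, -, -, p1, p2⟩
    have p0 : 0 < Pquart M Q Λ 0 := by simp [Pquart]; positivity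
    obtain ⟨X, hX, pX⟩ : ∃ X, s₂ < X ∧ Pquart M Q Λ X < 0 := by
      have hL : 0 < 1 / Λ := by positivity
      have hLL : Λ * (1 / Λ) = 1 := by field_simp
      have hQ2 : 0 ≤ Q ^ 2 := by positivity
      refine ⟨s₂ + 1 + 1 / Λ + Q ^ 2, by linarith, ?_⟩
      generalize hXX : s₂ + 1 + 1 / Λ + Q ^ 2 = X
      have x1 : 1 + Q ^ 2 ≤ X := by linarith
      have x2 : 1 ≤ Λ * X := by
        rw [← hLL]; exact mul_le_mul_of_nonneg_left (by linarith) hΛ.le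
      have x0 : 1 ≤ X := by linarith
      have x3 : X ^ 3 ≤ Λ * X ^ 4 := by
        have : 0 ≤ X ^ 3 * (Λ * X - 1) := mul_nonneg (by positivity) (by linarith)
        linarith [show X ^ 3 * (Λ * X - 1) = Λ * X ^ 4 - X ^ 3 by ring]
      have x4 : X ^ 2 * (1 + Q ^ 2) ≤ X ^ 3 := by
        have : 0 ≤ X ^ 2 * (X - (1 + Q ^ 2)) := mul_nonneg (by positivity) (by linarith)
        linarith [show X ^ 2 * (X - (1 + Q ^ 2)) = X ^ 3 - X ^ 2 * (1 + Q ^ 2) by ring]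
      have x5 : Q ^ 2 ≤ X ^ 2 * Q ^ 2 := le_mul_of_one_le_left hQ2 (one_le_pow₀ x0)
      have x6 : 0 < M * X := by positivity
      unfold Pquart
      linarith
    obtain ⟨r₁, ⟨a1, b1⟩, e1⟩ := intermediate_value_Ioo' hs1.le hcont.continuousOn ⟨p1, p0⟩
    obtain ⟨r₂, ⟨a2, b2⟩, e2⟩ := intermediate_value_Ioo hs.le hcont.continuousOn ⟨p1, p2⟩
    obtain ⟨r₃, ⟨a3, b3⟩, e3⟩ := intermediate_value_Ioo' hX.le hcont.continuousOn ⟨pX, p2⟩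
    exact ⟨r₁, r₂, r₃, a1, by linarith, by linarith, e1, e2, e3⟩
end

section
/- Assume P'(R) > 0 and 0 < Λ < 1/(12Q²), and let 0 < s₁ < R < s₂ be the two positive roots of P'. Then P(s₁) < 0 if and only if P'(m₁) < 0. -/
theorem mul_neg_iff_of_pos_left' {a b : ℝ} (h : 0 < a) : a * b < 0 ↔ b < 0 :=
  ⟨fun k => by by_contra hb; push Not at hb; exact absurd k (not_lt.mpr (mul_nonneg h.le hb)),
   fun k => mul_neg_of_pos_of_neg h k⟩

/-- If `P'(R) > 0` and `0 < Λ < 1/(12Q²)`, with `0 < s₁ < R < s₂` the two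
positive roots of `P'`, then `P(s₁) < 0 ↔ P'(m₁) < 0`. -/
theorem stmt_3 (M Q Λ : ℝ) (hM : 0 < M) (hΛ : 0 < Λ) (hQ : Q ≠ 0)
    (R Δ m₁ m₂ : ℝ)
    (hR : R = 1 / Real.sqrt (6 * Λ))
    (hΔ : Δ = 1 - 12 * Q ^ 2 * Λ)
    (hm₁ : m₁ = R * Real.sqrt (1 - Real.sqrt Δ))
    (hm₂ : m₂ = R * Real.sqrt (1 + Real.sqrt Δ))
    (hPR : Pquart' M Λ R > 0) (hΛQ : Λ < 1 / (12 * Q ^ 2))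
    (s₁ s₂ : ℝ) (hs₁ : 0 < s₁) (hs₁R : s₁ < R) (hRs₂ : R < s₂)
    (hPs₁ : Pquart' M Λ s₁ = 0) (hPs₂ : Pquart' M Λ s₂ = 0) :
    Pquart M Q Λ s₁ < 0 ↔ Pquart' M Λ m₁ < 0 := by
  have hQ2 : 0 < Q ^ 2 := by positivity
  have hD : 0 < Δ := by
    rw [lt_div_iff₀ (by positivity)] at hΛQ
    rw [hΔ]; linarith
  have hD1 : Δ < 1 := by
    have : 0 < Q ^ 2 * Λ := by positivity
    rw [hΔ]; linarith
  obtain ⟨d, hd⟩ : ∃ d, d = Real.sqrt Δ := ⟨_, rfl⟩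
  have hd0 : 0 < d := by rw [hd]; exact Real.sqrt_pos.mpr hD
  have hd2 : d ^ 2 = 1 - 12 * Q ^ 2 * Λ := by rw [hd, Real.sq_sqrt hD.le, hΔ]
  have hd1 : d < 1 := by nlinarith
  have hR0 : 0 < R := by rw [hR]; positivity
  have hR2 : 6 * Λ * R ^ 2 = 1 := by
    rw [hR, div_pow, Real.sq_sqrt (by positivity)]; field_simp
  rw [← hd] at hm₁
  have hm0 : 0 < m₁ := by
    rw [hm₁]; exact mul_pos hR0 (Real.sqrt_pos.mpr (by linarith))
  have hm2 : 6 * Λ * m₁ ^ 2 = 1 - d := by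
    rw [hm₁, mul_pow, Real.sq_sqrt (by linarith), ← mul_assoc, hR2, one_mul]
  have hmR : m₁ < R := by
    by_contra h
    push Not at h
    have h1 : R ^ 2 ≤ m₁ ^ 2 := by gcongr
    have := mul_le_mul_of_nonneg_left h1 (by positivity : (0:ℝ) ≤ 6 * Λ)
    linarith
  have hsR : 6 * Λ * s₁ ^ 2 < 1 := by rw [← hR2]; gcongr
  have hms : 6 * Λ * (m₁ * s₁) < 1 := by
    rw [← hR2, sq]; gcongr
  have e1 : 12 * Λ * Pquart M Q Λ s₁
      = (1 + d - 6 * Λ * s₁ ^ 2) * (6 * Λ * (m₁ + s₁)) * (m₁ - s₁) := by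
    unfold Pquart' at hPs₁
    unfold Pquart
    linear_combination (12 * Λ * s₁) * hPs₁ + hd2 - (1 + d - 6 * Λ * s₁ ^ 2) * hm2
  have e2 : Pquart' M Λ m₁ = (2 - 4 * Λ * (m₁ ^ 2 + m₁ * s₁ + s₁ ^ 2)) * (m₁ - s₁) := by
    unfold Pquart' at hPs₁ ⊢
    linear_combination hPs₁
  have p1 : 0 < (1 + d - 6 * Λ * s₁ ^ 2) * (6 * Λ * (m₁ + s₁)) :=
    mul_pos (by linarith) (by positivity)
  have p2 : 0 < 2 - 4 * Λ * (m₁ ^ 2 + m₁ * s₁ + s₁ ^ 2) := by linarith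
  rw [e2, mul_neg_iff_of_pos_left' p2, ← mul_neg_iff_of_pos_left' (by positivity : 0 < 12 * Λ), e1,
    mul_neg_iff_of_pos_left' p1]
end

section
/- Assume P'(R) > 0 and 0 < Λ < 1/(12Q²), and let 0 < s₁ < R < s₂ be the two positive roots of P'. Then P(s₂) > 0 if and only if P'(m₂) > 0. -/
/-- If `P'(R) > 0` and `0 < Λ < 1/(12Q²)`, with `0 < s₁ < R < s₂` the two
positive roots of `P'`, then `P(s₂) > 0 ↔ P'(m₂) > 0`. -/
theorem stmt_4 (M Q Λ : ℝ) (hM : 0 < M) (hΛ : 0 < Λ) (hQ : Q ≠ 0)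
    (R Δ m₁ m₂ : ℝ)
    (hR : R = 1 / Real.sqrt (6 * Λ))
    (hΔ : Δ = 1 - 12 * Q ^ 2 * Λ)
    (hm₁ : m₁ = R * Real.sqrt (1 - Real.sqrt Δ))
    (hm₂ : m₂ = R * Real.sqrt (1 + Real.sqrt Δ))
    (hPR : Pquart' M Λ R > 0) (hΛQ : Λ < 1 / (12 * Q ^ 2))
    (s₁ s₂ : ℝ) (hs₁ : 0 < s₁) (hs₁R : s₁ < R) (hRs₂ : R < s₂)
    (hPs₁ : Pquart' M Λ s₁ = 0) (hPs₂ : Pquart' M Λ s₂ = 0) :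
    Pquart M Q Λ s₂ > 0 ↔ Pquart' M Λ m₂ > 0 := by
  have hQ2 : 0 < Q ^ 2 := by positivity
  have hΔ0 : 0 < Δ := by
    rw [lt_div_iff₀ (by positivity)] at hΛQ
    rw [hΔ]; nlinarith
  have hd : 0 < Real.sqrt Δ := Real.sqrt_pos.mpr hΔ0
  have hd2 : Real.sqrt Δ ^ 2 = Δ := Real.sq_sqrt hΔ0.le
  generalize Real.sqrt Δ = d at *
  have hR0 : 0 < R := by rw [hR]; positivity
  have hR2 : 6 * Λ * R ^ 2 = 1 := by
    rw [hR, div_pow, Real.sq_sqrt (by positivity)]; field_simp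
  have hm2 : 6 * Λ * m₂ ^ 2 = 1 + d := by
    rw [hm₂, mul_pow, Real.sq_sqrt (by positivity), ← mul_assoc, hR2, one_mul]
  have hm20 : 0 ≤ m₂ := by rw [hm₂]; positivity
  have hRm : R < m₂ := by
    apply lt_of_pow_lt_pow_left₀ 2 hm20
    have : 6 * Λ * R ^ 2 < 6 * Λ * m₂ ^ 2 := by rw [hR2, hm2]; linarith
    exact lt_of_mul_lt_mul_left this (by positivity)
  have hs0 : 0 < s₂ := hR0.trans hRs₂
  unfold Pquart' at hPs₂ ⊢
  unfold Pquart
  have h1 : R ^ 2 < s₂ ^ 2 := by gcongr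
  have h2 : R ^ 2 < m₂ ^ 2 := by gcongr
  have h3 : R ^ 2 < m₂ * s₂ := by nlinarith
  have hA : 0 < 6 * Λ * s₂ ^ 2 - 1 + d := by
    have := mul_lt_mul_of_pos_left h1 (show 0 < 6 * Λ by positivity)
    linarith
  have hB : 0 < 4 * Λ * (m₂ ^ 2 + m₂ * s₂ + s₂ ^ 2) - 2 := by
    have := mul_lt_mul_of_pos_left (show 3 * R ^ 2 < m₂ ^ 2 + m₂ * s₂ + s₂ ^ 2 by linarith)
      (show 0 < 4 * Λ by positivity)
    linarith
  have e1 : 2 * (-Λ * s₂ ^ 4 + s₂ ^ 2 - 2 * M * s₂ + Q ^ 2)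
      = (s₂ - m₂) * ((s₂ + m₂) * (6 * Λ * s₂ ^ 2 - 1 + d)) := by
    have h : (6 * Λ) * (2 * (-Λ * s₂ ^ 4 + s₂ ^ 2 - 2 * M * s₂ + Q ^ 2))
      = (6 * Λ) * ((s₂ - m₂) * ((s₂ + m₂) * (6 * Λ * s₂ ^ 2 - 1 + d))) := by
      linear_combination (12 * Λ * s₂) * hPs₂ + hd2 + hΔ + (6 * Λ * s₂ ^ 2 - 1 + d) * hm2
    exact mul_left_cancel₀ (by positivity) h
  have e2 : -4 * Λ * m₂ ^ 3 + 2 * m₂ - 2 * M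
      = (s₂ - m₂) * (4 * Λ * (m₂ ^ 2 + m₂ * s₂ + s₂ ^ 2) - 2) := by
    linear_combination hPs₂
  have hC : 0 < (s₂ + m₂) * (6 * Λ * s₂ ^ 2 - 1 + d) := by positivity
  have i1 : 0 < (s₂ - m₂) * _ ↔ 0 < s₂ - m₂ := mul_pos_iff_of_pos_right hC
  have i2 : 0 < (s₂ - m₂) * _ ↔ 0 < s₂ - m₂ := mul_pos_iff_of_pos_right hB
  rw [gt_iff_lt, gt_iff_lt, e2, i2, ← i1, ← e1]
  constructor <;> intro h <;> linarith
end

section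
/- If P'(R) > 0, then P' has exactly three real roots: exactly one root in (−∞, 0), and exactly two roots s₁, s₂ in (0, +∞) satisfying 0 < s₁ < R < s₂. Moreover P' changes sign at s₁ and s₂, so that P(s₁) is a local minimum and P(s₂) is a local maximum of P on [0, +∞). -/
/-- If `P'(R) > 0`, then `P'` has exactly one root in `(-∞,0)` and exactly
two roots `s₁ < R < s₂` in `(0,+∞)`; moreover `P'` changes sign at `s₁` and `s₂` (negative
on `(0,s₁)`, positive on `(s₁,s₂)`, negative on `(s₂,∞)`), so that `P(s₁)` is a local
minimum and `P(s₂)` a local maximum of `P` on `[0,+∞)`. -/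
theorem stmt_7 (M Q Λ : ℝ) (hM : 0 < M) (hΛ : 0 < Λ) (hQ : Q ≠ 0)
    (R : ℝ) (hR : R = 1 / Real.sqrt (6 * Λ))
    (hPR : Pquart' M Λ R > 0) :
    (∃! r : ℝ, r < 0 ∧ Pquart' M Λ r = 0) ∧
    (∃ s₁ s₂ : ℝ, 0 < s₁ ∧ s₁ < R ∧ R < s₂ ∧
      {s : ℝ | 0 < s ∧ Pquart' M Λ s = 0} = {s₁, s₂} ∧
      (∀ r : ℝ, 0 < r → r < s₁ → Pquart' M Λ r < 0) ∧
      (∀ r : ℝ, s₁ < r → r < s₂ → Pquart' M Λ r > 0) ∧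
      (∀ r : ℝ, s₂ < r → Pquart' M Λ r < 0) ∧
      IsLocalMinOn (Pquart M Q Λ) (Set.Ici 0) s₁ ∧
      IsLocalMaxOn (Pquart M Q Λ) (Set.Ici 0) s₂) := by
  have hR0 : 0 < R := by rw [hR]; positivity
  have hR2 : 6 * Λ * R ^ 2 = 1 := by
    rw [hR, div_pow, Real.sq_sqrt (by positivity)]; field_simp
  have hc : Continuous (Pquart' M Λ) := by unfold Pquart'; fun_prop
  obtain ⟨s₁, ⟨h1, h2⟩, e1⟩ : ∃ s ∈ Set.Ioo 0 R, Pquart' M Λ s = 0 :=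
    intermediate_value_Ioo hR0.le hc.continuousOn ⟨by simp [Pquart']; linarith, hPR⟩
  have h2R : Pquart' M Λ (2 * R) < 0 := by
    have : Pquart' M Λ (2 * R) = -(16 / 3) * R * (6 * Λ * R ^ 2) + 4 * R - 2 * M := by
      unfold Pquart'; ring
    rw [this, hR2]; linarith
  obtain ⟨s₂, ⟨h3, -⟩, e2⟩ : ∃ s ∈ Set.Ioo R (2 * R), Pquart' M Λ s = 0 :=
    intermediate_value_Ioo' (by linarith) hc.continuousOn ⟨h2R, hPR⟩
  have hs2 : 0 < s₂ := hR0.trans h3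
  have k1 : 4 * Λ * (s₁ ^ 2 + s₁ * s₂ + s₂ ^ 2) = 2 := by
    have : s₂ - s₁ ≠ 0 := by intro h; linarith
    apply mul_left_cancel₀ this
    unfold Pquart' at e1 e2
    linear_combination e1 - e2
  have fac : ∀ r, Pquart' M Λ r = 4 * Λ * ((r - s₁) * (s₂ - r) * (r + s₁ + s₂)) := by
    intro r
    unfold Pquart' at e1 ⊢
    linear_combination e1 - (r - s₁) * k1
  have root : ∀ r, Pquart' M Λ r = 0 → r = s₁ ∨ r = s₂ ∨ r = -(s₁ + s₂) := by
    intro r h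
    rw [fac] at h
    have h4 : 4 * Λ ≠ 0 := by positivity
    rcases mul_eq_zero.1 ((mul_eq_zero.1 h).resolve_left h4) with h | h
    · rcases mul_eq_zero.1 h with h | h
      · left; linarith
      · right; left; linarith
    · right; right; linarith
  have hP : ∀ s r, Pquart' M Λ s = 0 →
      Pquart M Q Λ r - Pquart M Q Λ s = (r - s) ^ 2 * (1 - Λ * (r ^ 2 + 2 * s * r + 3 * s ^ 2)) := by
    intro s r h
    unfold Pquart' at h
    unfold Pquart
    linear_combination (r - s) * h
  have hg : ∀ s : ℝ, Continuous (fun r : ℝ => 1 - Λ * (r ^ 2 + 2 * s * r + 3 * s ^ 2)) := by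
    intro s; fun_prop
  refine ⟨⟨-(s₁ + s₂), ⟨by linarith, by rw [fac]; ring⟩, ?_⟩, s₁, s₂, h1, h2, h3, ?_, ?_, ?_, ?_, ?_, ?_⟩
  · rintro r ⟨hr, h⟩
    rcases root r h with h | h | h <;> linarith
  · ext r
    simp only [Set.mem_setOf_eq, Set.mem_insert_iff, Set.mem_singleton_iff]
    constructor
    · rintro ⟨hr, h⟩
      rcases root r h with h | h | h
      · exact Or.inl h
      · exact Or.inr h
      · linarith
    · rintro (h | h)
      · subst h; exact ⟨h1, e1⟩
      · subst h; exact ⟨hs2, e2⟩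
  · intro r hr hr1
    rw [fac]
    have a : 0 < s₁ - r := by linarith
    have b : 0 < s₂ - r := by linarith
    have : 0 < 4 * Λ * ((s₁ - r) * (s₂ - r) * (r + s₁ + s₂)) := by positivity
    linarith
  · intro r hr hr1
    rw [fac]
    have a : 0 < r - s₁ := by linarith
    have b : 0 < s₂ - r := by linarith
    have c : 0 < r := by linarith
    positivity
  · intro r hr
    rw [fac]
    have a : 0 < r - s₁ := by linarith
    have b : 0 < r - s₂ := by linarith
    have c : 0 < r := by linarith
    have : 0 < 4 * Λ * ((r - s₁) * (r - s₂) * (r + s₁ + s₂)) := by positivity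
    linarith
  · apply IsLocalMin.on
    have hlt : s₁ ^ 2 < R ^ 2 := by gcongr
    have h0 : 0 < 1 - Λ * (s₁ ^ 2 + 2 * s₁ * s₁ + 3 * s₁ ^ 2) := by
      have := mul_lt_mul_of_pos_left hlt hΛ
      linarith
    filter_upwards [(hg s₁).continuousAt.eventually (lt_mem_nhds h0)] with r hr
    have := mul_nonneg (sq_nonneg (r - s₁)) hr.le
    have := hP s₁ r e1
    linarith
  · apply IsLocalMax.on
    have hlt : R ^ 2 < s₂ ^ 2 := by gcongr
    have h0 : 1 - Λ * (s₂ ^ 2 + 2 * s₂ * s₂ + 3 * s₂ ^ 2) < 0 := by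
      have := mul_lt_mul_of_pos_left hlt hΛ
      linarith
    filter_upwards [(hg s₂).continuousAt.eventually (gt_mem_nhds h0)] with r hr
    have := mul_nonpos_of_nonneg_of_nonpos (sq_nonneg (r - s₂)) hr.le
    have := hP s₂ r e2
    linarith
end

section
/- Assume P'(R) > 0 and let 0 < s₁ < R < s₂ be the two positive roots of P'. If P(s₁) < 0 and P(s₂) > 0, then P has exactly three roots r₁ < r₂ < r₃ in (0, +∞), and they satisfy 0 < r₁ < s₁ < r₂ < s₂ < r₃. -/
/-- Assume `P'(R) > 0` with positive roots `0 < s₁ < R < s₂` of `P'`.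
If `P(s₁) < 0` and `P(s₂) > 0`, then `P` has exactly three roots in `(0,+∞)`, and they
satisfy `0 < r₁ < s₁ < r₂ < s₂ < r₃`. -/
theorem stmt_8 (M Q Λ : ℝ) (hM : 0 < M) (hΛ : 0 < Λ) (hQ : Q ≠ 0)
    (R : ℝ) (hR : R = 1 / Real.sqrt (6 * Λ))
    (hPR : Pquart' M Λ R > 0)
    (s₁ s₂ : ℝ) (hs₁ : 0 < s₁) (hs₁R : s₁ < R) (hRs₂ : R < s₂)
    (hPs₁ : Pquart' M Λ s₁ = 0) (hPs₂ : Pquart' M Λ s₂ = 0)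
    (hPs₁neg : Pquart M Q Λ s₁ < 0) (hPs₂pos : Pquart M Q Λ s₂ > 0) :
    ∃ r₁ r₂ r₃ : ℝ, 0 < r₁ ∧ r₁ < s₁ ∧ s₁ < r₂ ∧ r₂ < s₂ ∧ s₂ < r₃ ∧
      {r : ℝ | 0 < r ∧ Pquart M Q Λ r = 0} = {r₁, r₂, r₃} := by
  have hc : Continuous (fun r => Pquart M Q Λ r) := by
    unfold Pquart; fun_prop
  have hQ2 : 0 < Q ^ 2 := by positivity
  have h0 : 0 < Pquart M Q Λ 0 := by simpa [Pquart] using hQ2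
  have hs12 : s₁ < s₂ := hs₁R.trans hRs₂
  obtain ⟨T, hT2, hT⟩ : ∃ T, s₂ < T ∧ Pquart M Q Λ T < 0 := by
    have hd : 0 < (1 + Q ^ 2) / Λ := by positivity
    refine ⟨s₂ + 1 + (1 + Q ^ 2) / Λ, by linarith, ?_⟩
    have hT1 : 1 < s₂ + 1 + (1 + Q ^ 2) / Λ := by linarith
    have hT3 : 1 + Q ^ 2 ≤ Λ * (s₂ + 1 + (1 + Q ^ 2) / Λ) := by
      have : Λ * ((1 + Q ^ 2) / Λ) = 1 + Q ^ 2 := by field_simp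
      nlinarith
    generalize s₂ + 1 + (1 + Q ^ 2) / Λ = T at hT1 hT3
    unfold Pquart
    have h2 : T ^ 2 ≤ T ^ 3 := pow_le_pow_right₀ hT1.le (by norm_num)
    have h3 : 1 ≤ T ^ 3 := one_le_pow₀ hT1.le
    have h4 : (1 + Q ^ 2) * T ^ 3 ≤ Λ * T * T ^ 3 :=
      mul_le_mul_of_nonneg_right hT3 (by positivity)
    have h5 : Q ^ 2 * 1 ≤ Q ^ 2 * T ^ 3 := mul_le_mul_of_nonneg_left h3 hQ2.le
    have h6 : 0 < M * T := by positivity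
    nlinarith
  obtain ⟨r₁, ⟨ha1, hb1⟩, h1⟩ := intermediate_value_Ioo' hs₁.le hc.continuousOn ⟨hPs₁neg, h0⟩
  obtain ⟨r₂, ⟨ha2, hb2⟩, h2⟩ := intermediate_value_Ioo hs12.le hc.continuousOn ⟨hPs₁neg, hPs₂pos⟩
  obtain ⟨r₃, ⟨ha3, hb3⟩, h3⟩ := intermediate_value_Ioo' hT2.le hc.continuousOn ⟨hT, hPs₂pos⟩
  simp only at h1 h2 h3
  refine ⟨r₁, r₂, r₃, ha1, hb1, ha2, hb2, ha3, ?_⟩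
  ext r
  simp only [Set.mem_setOf_eq, Set.mem_insert_iff, Set.mem_singleton_iff]
  constructor
  · rintro ⟨hr, h⟩
    by_contra! hne
    obtain ⟨n1, n2, n3⟩ := hne
    unfold Pquart at h h1 h2 h3
    have e1 : -Λ * (r ^ 3 + r ^ 2 * r₁ + r * r₁ ^ 2 + r₁ ^ 3) + (r + r₁) - 2 * M = 0 := by
      apply mul_left_cancel₀ (sub_ne_zero.2 n1); linear_combination h - h1
    have e2 : -Λ * (r₂ ^ 3 + r₂ ^ 2 * r₁ + r₂ * r₁ ^ 2 + r₁ ^ 3) + (r₂ + r₁) - 2 * M = 0 := by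
      apply mul_left_cancel₀ (sub_ne_zero.2 (by linarith : r₁ < r₂).ne'); linear_combination h2 - h1
    have e3 : -Λ * (r₃ ^ 3 + r₃ ^ 2 * r₁ + r₃ * r₁ ^ 2 + r₁ ^ 3) + (r₃ + r₁) - 2 * M = 0 := by
      apply mul_left_cancel₀ (sub_ne_zero.2 (by linarith : r₁ < r₃).ne'); linear_combination h3 - h1
    have f1 : -Λ * (r ^ 2 + r * r₂ + r₂ ^ 2 + (r + r₂) * r₁ + r₁ ^ 2) + 1 = 0 := by
      apply mul_left_cancel₀ (sub_ne_zero.2 n2); linear_combination e1 - e2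
    have f2 : -Λ * (r₃ ^ 2 + r₃ * r₂ + r₂ ^ 2 + (r₃ + r₂) * r₁ + r₁ ^ 2) + 1 = 0 := by
      apply mul_left_cancel₀ (sub_ne_zero.2 (by linarith : r₂ < r₃).ne'); linear_combination e3 - e2
    have g : -Λ * (r + r₁ + r₂ + r₃) = 0 := by
      apply mul_left_cancel₀ (sub_ne_zero.2 n3); linear_combination f1 - f2
    have : 0 < Λ * (r + r₁ + r₂ + r₃) := mul_pos hΛ (by linarith)
    linarith
  · rintro (rfl | rfl | rfl)
    · exact ⟨ha1, h1⟩
    · exact ⟨by linarith, h2⟩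
    · exact ⟨by linarith, h3⟩
end

section
/- If Q ≠ 0 and Λ ≥ 1/(12Q²), then T(r) = 3Λr⁴ − r² + Q² ≥ 0 for all real r; consequently, for any M > 0, the polynomial P(r) = −Λr⁴ + r² − 2Mr + Q² does not have three distinct roots in (0, +∞). -/
/-- The polynomial `T(r) = 3 Λ r⁴ - r² + Q²` appearing in `P(r) = r P'(r) + T(r)`. -/
noncomputable def Tpoly (Q Λ r : ℝ) : ℝ := 3 * Λ * r ^ 4 - r ^ 2 + Q ^ 2

/-- If `Q ≠ 0` and `Λ ≥ 1/(12Q²)`, then `T(r) ≥ 0` for all real `r`;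
consequently, for any `M > 0`, the polynomial `P` does not have three distinct roots
in `(0, +∞)`. -/
theorem stmt_10 (Q Λ : ℝ) (hQ : Q ≠ 0) (hΛ : 0 < Λ) (hΛQ : Λ ≥ 1 / (12 * Q ^ 2)) :
    (∀ r : ℝ, 0 ≤ Tpoly Q Λ r) ∧
    (∀ M : ℝ, 0 < M →
      ¬ ∃ r₁ r₂ r₃ : ℝ, 0 < r₁ ∧ r₁ < r₂ ∧ r₂ < r₃ ∧
        Pquart M Q Λ r₁ = 0 ∧ Pquart M Q Λ r₂ = 0 ∧ Pquart M Q Λ r₃ = 0) := by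
  have hQ2 : 0 < Q ^ 2 := by positivity
  have h1 : 1 ≤ 12 * Λ * Q ^ 2 := by
    have := (div_le_iff₀ (by positivity : (0:ℝ) < 12 * Q ^ 2)).1 hΛQ
    linarith
  have key : ∀ t : ℝ, 0 ≤ 3 * Λ * t ^ 2 - t + Q ^ 2 := by
    intro t
    have h : 0 ≤ (12 * Λ) * (3 * Λ * t ^ 2 - t + Q ^ 2) := by
      nlinarith [sq_nonneg (6 * Λ * t - 1)]
    exact nonneg_of_mul_nonneg_right h (by positivity)
  refine ⟨fun r => ?_, ?_⟩
  · have := key (r ^ 2)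
    unfold Tpoly
    nlinarith
  · rintro M hM ⟨a, b, c, ha, hab, -, h2, h3, -⟩
    unfold Pquart at h2 h3
    have hb : 0 < b := ha.trans hab
    have e : (b - a) * (Λ * (a * b) * (a ^ 2 + a * b + b ^ 2) - a * b + Q ^ 2) = 0 := by
      linear_combination b * h2 - a * h3
    have e2 : Λ * (a * b) * (a ^ 2 + a * b + b ^ 2) - a * b + Q ^ 2 = 0 :=
      (mul_eq_zero.1 e).resolve_left (sub_pos.2 hab).ne'
    have h5 : 0 < Λ * (a * b) * (b - a) ^ 2 := by
      have := sub_pos.2 hab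
      positivity
    have := key (a * b)
    nlinarith
end

section
/- If Q ≠ 0 and 0 < Λ < 1/(12Q²), then 0 < M₁ < M₂ < (2/3)R. -/
/-- If `Q ≠ 0` and `0 < Λ < 1/(12Q²)`, then `0 < M₁ < M₂ < (2/3) R`. -/
theorem stmt_11 (Q Λ : ℝ) (hQ : Q ≠ 0) (hΛ : 0 < Λ) (hΛQ : Λ < 1 / (12 * Q ^ 2))
    (R Δ m₁ m₂ M₁ M₂ : ℝ)
    (hR : R = 1 / Real.sqrt (6 * Λ))
    (hΔ : Δ = 1 - 12 * Q ^ 2 * Λ)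
    (hm₁ : m₁ = R * Real.sqrt (1 - Real.sqrt Δ))
    (hm₂ : m₂ = R * Real.sqrt (1 + Real.sqrt Δ))
    (hM₁ : M₁ = m₁ - 2 * Λ * m₁ ^ 3)
    (hM₂ : M₂ = m₂ - 2 * Λ * m₂ ^ 3) :
    0 < M₁ ∧ M₁ < M₂ ∧ M₂ < (2 / 3) * R := by
  have hQ2 : 0 < Q ^ 2 := by positivity
  have h12 : Λ * (12 * Q ^ 2) < 1 := (lt_div_iff₀ (by positivity)).mp hΛQ
  have hp : 0 < Q ^ 2 * Λ := by positivity
  have hΔ0 : 0 < Δ := by rw [hΔ]; linarith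
  have hΔ1 : Δ < 1 := by rw [hΔ]; linarith
  have hs0 : 0 < Real.sqrt Δ := Real.sqrt_pos.mpr hΔ0
  have hss : Real.sqrt Δ ^ 2 = Δ := Real.sq_sqrt hΔ0.le
  have hs1 : Real.sqrt Δ < 1 := by nlinarith
  generalize Real.sqrt Δ = s at *
  have hRpos : 0 < R := by rw [hR]; positivity
  have hR2 : 2 * Λ * R ^ 2 = 1 / 3 := by
    rw [hR, div_pow, Real.sq_sqrt (by positivity)]
    field_simp
    norm_num
  have ha0 : 0 < Real.sqrt (1 - s) := Real.sqrt_pos.mpr (by linarith)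
  have hb0 : 0 < Real.sqrt (1 + s) := Real.sqrt_pos.mpr (by linarith)
  have ha : Real.sqrt (1 - s) ^ 2 = 1 - s := Real.sq_sqrt (by linarith)
  have hb : Real.sqrt (1 + s) ^ 2 = 1 + s := Real.sq_sqrt (by linarith)
  generalize Real.sqrt (1 - s) = a at *
  generalize Real.sqrt (1 + s) = b at *
  have e1 : M₁ = R / 3 * (a * (2 + s)) := by
    rw [hM₁, hm₁]
    linear_combination (-R * a ^ 3) * hR2 - R * a / 3 * ha
  have e2 : M₂ = R / 3 * (b * (2 - s)) := by
    rw [hM₂, hm₂]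
    linear_combination (-R * b ^ 3) * hR2 - R * b / 3 * hb
  have hs3 : 0 < s ^ 3 := by positivity
  have k1 : a * (2 + s) < b * (2 - s) := by
    apply lt_of_pow_lt_pow_left₀ 2 (mul_nonneg hb0.le (by linarith))
    rw [mul_pow, mul_pow, ha, hb]
    nlinarith
  have k2 : b * (2 - s) < 2 := by
    apply lt_of_pow_lt_pow_left₀ 2 (by norm_num)
    rw [mul_pow, hb]
    nlinarith [mul_pos (pow_pos hs0 2) (sub_pos.mpr hs1), pow_pos hs0 2]
  have hR3 : 0 < R / 3 := by positivity
  refine ⟨?_, ?_, ?_⟩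
  · rw [e1]; positivity
  · rw [e1, e2]; exact mul_lt_mul_of_pos_left k1 hR3
  · rw [e2]; linarith [mul_lt_mul_of_pos_left k2 hR3]
end

section
/- Assume the conditions (GC) hold and let 0 < r₁ < r₂ < r₃ be the three positive roots of f. Then the function 1/f is integrable on (0, c] for every c ∈ (0, r₁), and integrable on [c', +∞) for every c' > r₃. Consequently, the tortoise coordinate r_* has finite limits as r → 0⁺ and as r → +∞. -/
open Filter Topology

lemma hF_ne (M Q Λ r₁ r₂ r₃ : ℝ)
    (hroots : {r : ℝ | 0 < r ∧ horizonF M Q Λ r = 0} = {r₁, r₂, r₃}) (s : ℝ) (hs : 0 < s)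
    (a : s ≠ r₁) (b : s ≠ r₂) (c : s ≠ r₃) : horizonF M Q Λ s ≠ 0 := by
  intro h
  have : s ∈ ({r₁, r₂, r₃} : Set ℝ) := by rw [← hroots]; exact ⟨hs, h⟩
  simp at this
  tauto

lemma hF_eq (M Q Λ s : ℝ) (hs : s ≠ 0) :
    horizonF M Q Λ s = (s ^ 2 - 2 * M * s + Q ^ 2 - Λ * s ^ 4) / s ^ 2 := by
  unfold horizonF
  field_simp

lemma int_zero (M Q Λ : ℝ) (hQ : Q ≠ 0) (c : ℝ)
    (hne : ∀ s, 0 < s → s ≤ c → horizonF M Q Λ s ≠ 0) :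
    MeasureTheory.IntegrableOn (fun s : ℝ => 1 / horizonF M Q Λ s) (Set.Ioc 0 c) := by
  have hc : ContinuousOn (fun s : ℝ => s ^ 2 / (s ^ 2 - 2 * M * s + Q ^ 2 - Λ * s ^ 4))
      (Set.Icc 0 c) := by
    apply ContinuousOn.div (by fun_prop) (by fun_prop)
    intro s hs
    rcases hs.1.eq_or_lt with h | h
    · subst h; simpa using hQ
    · intro h0
      apply hne s h hs.2
      rw [hF_eq _ _ _ _ h.ne', h0, zero_div]
  have := (hc.integrableOn_Icc (μ := MeasureTheory.volume)).mono_set Set.Ioc_subset_Icc_self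
  refine this.congr_fun ?_ measurableSet_Ioc
  intro s hs
  simp only
  rw [hF_eq _ _ _ _ hs.1.ne', one_div_div]

lemma int_top (M Q Λ : ℝ) (hM : 0 < M) (hΛ : 0 < Λ) (c : ℝ) (hc0 : 0 < c)
    (hne : ∀ s, c ≤ s → horizonF M Q Λ s ≠ 0) :
    MeasureTheory.IntegrableOn (fun s : ℝ => 1 / horizonF M Q Λ s) (Set.Ici c) := by
  have hc : ContinuousOn (fun s : ℝ => 1 / horizonF M Q Λ s) (Set.Ici c) := by
    apply ContinuousOn.div continuousOn_const _ (fun s hs => hne s hs)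
    have h0 : ∀ s ∈ Set.Ici c, s ≠ 0 := fun s hs => (hc0.trans_le hs).ne'
    have h0' : ∀ s ∈ Set.Ici c, s ^ 2 ≠ 0 := fun s hs => pow_ne_zero 2 (h0 s hs)
    unfold horizonF
    fun_prop (disch := assumption)
  refine (hc.locallyIntegrableOn measurableSet_Ici).integrableOn_of_isBigO_atTop
    (g := fun s : ℝ => s ^ (-2 : ℝ)) ?_
    ⟨Set.Ioi 1, Ioi_mem_atTop 1, integrableOn_Ioi_rpow_of_lt (by norm_num) one_pos⟩
  refine Asymptotics.IsBigO.of_bound (2 / Λ) ?_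
  filter_upwards [eventually_ge_atTop 1, eventually_ge_atTop (2 * (1 + Q ^ 2) / Λ)] with s h1 h2
  have hs : 0 < s := by linarith
  rw [div_le_iff₀ hΛ] at h2
  have h3 : Λ / 2 * s ^ 4 ≤ -(s ^ 2 - 2 * M * s + Q ^ 2 - Λ * s ^ 4) := by
    have e1 : 1 ≤ s ^ 2 := by nlinarith
    have e2 : s ≤ s ^ 2 := by nlinarith
    have e3 : 2 * (1 + Q ^ 2) ≤ s ^ 2 * Λ := by nlinarith
    have e4 : 2 * (1 + Q ^ 2) * s ^ 2 ≤ s ^ 2 * Λ * s ^ 2 := by gcongr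
    have e5 : Q ^ 2 * 1 ≤ Q ^ 2 * s ^ 2 := by gcongr
    have e6 : 0 < M * s := by positivity
    nlinarith
  have h4 : 0 < Λ / 2 * s ^ 4 := by positivity
  rw [hF_eq _ _ _ _ hs.ne', one_div_div, Real.rpow_neg hs.le, norm_div, norm_inv,
    ← norm_neg (s ^ 2 - 2 * M * s + Q ^ 2 - Λ * s ^ 4), Real.norm_of_nonneg (h4.le.trans h3)]
  have e : ‖s ^ (2 : ℝ)‖ = s ^ 2 := by
    rw [Real.rpow_two, Real.norm_of_nonneg (by positivity)]
  rw [e, Real.norm_of_nonneg (by positivity)]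
  calc s ^ 2 / _ ≤ s ^ 2 / (Λ / 2 * s ^ 4) := by gcongr
    _ = _ := by field_simp

/-- Under (GC), with `0 < r₁ < r₂ < r₃` the three positive roots of `f`,
the function `1/f` is integrable on `(0, c]` for every `c ∈ (0, r₁)` and on `[c', +∞)` for
every `c' > r₃`; consequently the tortoise coordinate `r_*` (an antiderivative of `1/f`)
has finite limits as `r → 0⁺` and as `r → +∞`. -/
theorem stmt_16 (M Q Λ : ℝ) (hM : 0 < M) (hΛ : 0 < Λ) (hQ : Q ≠ 0)
    (R Δ m₁ m₂ M₁ M₂ : ℝ)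
    (hR : R = 1 / Real.sqrt (6 * Λ))
    (hΔ : Δ = 1 - 12 * Q ^ 2 * Λ)
    (hm₁ : m₁ = R * Real.sqrt (1 - Real.sqrt Δ))
    (hm₂ : m₂ = R * Real.sqrt (1 + Real.sqrt Δ))
    (hM₁ : M₁ = m₁ - 2 * Λ * m₁ ^ 3)
    (hM₂ : M₂ = m₂ - 2 * Λ * m₂ ^ 3)
    (hGC : Q ≠ 0 ∧ 0 < Λ ∧ Λ < 1 / (12 * Q ^ 2) ∧ M₁ < M ∧ M < M₂)
    (r₁ r₂ r₃ : ℝ) (h₁ : 0 < r₁) (h₁₂ : r₁ < r₂) (h₂₃ : r₂ < r₃)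
    (hroots : {r : ℝ | 0 < r ∧ horizonF M Q Λ r = 0} = {r₁, r₂, r₃}) :
    (∀ c ∈ Set.Ioo 0 r₁,
      MeasureTheory.IntegrableOn (fun s : ℝ => 1 / horizonF M Q Λ s) (Set.Ioc 0 c)) ∧
    (∀ c' : ℝ, r₃ < c' →
      MeasureTheory.IntegrableOn (fun s : ℝ => 1 / horizonF M Q Λ s) (Set.Ici c')) ∧
    (∀ c ∈ Set.Ioo 0 r₁, ∃ L : ℝ,
      Tendsto (fun r : ℝ => ∫ s in c..r, 1 / horizonF M Q Λ s) (𝓝[>] 0) (𝓝 L)) ∧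
    (∀ c' : ℝ, r₃ < c' → ∃ L : ℝ,
      Tendsto (fun r : ℝ => ∫ s in c'..r, 1 / horizonF M Q Λ s) atTop (𝓝 L)) := by
  have hz : ∀ c ∈ Set.Ioo 0 r₁,
      MeasureTheory.IntegrableOn (fun s : ℝ => 1 / horizonF M Q Λ s) (Set.Ioc 0 c) := by
    intro c hc
    refine int_zero M Q Λ hQ c fun s h0 h1 => ?_
    have := hc.2
    exact hF_ne M Q Λ r₁ r₂ r₃ hroots s h0 (ne_of_lt (by linarith)) (ne_of_lt (by linarith)) (ne_of_lt (by linarith))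
  have ht : ∀ c' : ℝ, r₃ < c' →
      MeasureTheory.IntegrableOn (fun s : ℝ => 1 / horizonF M Q Λ s) (Set.Ici c') := by
    intro c hc
    refine int_top M Q Λ hM hΛ c (by linarith) fun s h0 => ?_
    exact hF_ne M Q Λ r₁ r₂ r₃ hroots s (by linarith) (ne_of_gt (by linarith)) (ne_of_gt (by linarith))
      (ne_of_gt (by linarith))
  refine ⟨hz, ht, ?_, ?_⟩
  · intro c hc
    have hi : IntervalIntegrable (fun s : ℝ => 1 / horizonF M Q Λ s) MeasureTheory.volume 0 c :=
      (intervalIntegrable_iff_integrableOn_Ioc_of_le hc.1.le).2 (hz c hc)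
    have hcont := intervalIntegral.continuousOn_primitive_interval' hi
      (a := c) Set.right_mem_uIcc
    have h0 := hcont 0 Set.left_mem_uIcc
    refine ⟨_, h0.tendsto.mono_left ?_⟩
    rw [Set.uIcc_of_le hc.1.le, nhdsWithin_Icc_eq_nhdsGE hc.1]
    exact nhdsWithin_mono _ Set.Ioi_subset_Ici_self
  · intro c hc
    exact ⟨_, MeasureTheory.intervalIntegral_tendsto_integral_Ioi c
      ((ht c hc).mono_set Set.Ioi_subset_Ici_self) tendsto_id⟩
end

section
/- Let M > 0, Λ > 0, Q ≠ 0, let E > 0 and C be real numbers, and let u : I → (0, +∞) be a function on a nonempty set I such that every τ ∈ I admits a real number v(τ) with v(τ)² = C − E·f(u(τ)) (the radial timelike geodesic constraint ṙ² = C − fE). Then there exists δ > 0 such that u(τ) ≥ δ for all τ ∈ I; in other words, radial timelike geodesics cannot reach the singularity r = 0, since f(r) → +∞ as r → 0⁺. -/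
/-- Let `E > 0`, `C ∈ ℝ`, and let `u` take positive values on a nonempty
set `I` such that for each `τ ∈ I` there is `v` with `v² = C - E f(u τ)` (the radial
timelike geodesic constraint `ṙ² = C - fE`). Then `u` is bounded below on `I` by some
`δ > 0`: radial timelike geodesics cannot reach the singularity `r = 0`. -/
theorem stmt_18 (M Q Λ : ℝ) (hM : 0 < M) (hΛ : 0 < Λ) (hQ : Q ≠ 0)
    (E C : ℝ) (hE : 0 < E)
    (I : Set ℝ) (hI : I.Nonempty) (u : ℝ → ℝ)
    (hu : ∀ τ ∈ I, 0 < u τ)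
    (hv : ∀ τ ∈ I, ∃ v : ℝ, v ^ 2 = C - E * horizonF M Q Λ (u τ)) :
    ∃ δ : ℝ, 0 < δ ∧ ∀ τ ∈ I, δ ≤ u τ := by
  have hQ2 : 0 < Q ^ 2 := by positivity
  have hEQ : 0 < E * Q ^ 2 := by positivity
  have hK : 0 < |C| + 2 * M * E + E * Λ := by positivity
  refine ⟨min 1 (E * Q ^ 2 / (|C| + 2 * M * E + E * Λ)), lt_min one_pos (div_pos hEQ hK), ?_⟩
  intro τ hτ
  obtain ⟨v, h⟩ := hv τ hτ
  have hr := hu τ hτ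
  generalize u τ = r at h hr
  rcases le_or_gt 1 r with h1 | h1
  · exact (min_le_left _ _).trans h1
  refine (min_le_right _ _).trans ?_
  rw [div_le_iff₀ hK]
  have key : E * (r ^ 2 - 2 * M * r + Q ^ 2 - Λ * r ^ 4) = (C - v ^ 2) * r ^ 2 := by
    rw [h]
    unfold horizonF
    field_simp
    ring
  have hv2 : 0 ≤ v ^ 2 * r ^ 2 := by positivity
  have h2 : r ^ 2 ≤ r := by nlinarith
  have h4 : r ^ 4 ≤ r := by nlinarith [sq_nonneg r]
  have hC : C * r ^ 2 ≤ |C| * r :=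
    mul_le_mul (le_abs_self C) h2 (sq_nonneg r) (abs_nonneg C)
  have hL : (E * Λ) * r ^ 4 ≤ (E * Λ) * r := mul_le_mul_of_nonneg_left h4 (by positivity)
  have hE2 : 0 ≤ E * r ^ 2 := by positivity
  nlinarith
end

section
/- Assume the conditions (GC) hold. Then 9M² − 8Q² > 0; equivalently, M > (2√2/3)·|Q|, so the quadratic S(r) = −r² + 3Mr − 2Q² has two distinct positive roots P₁ = (3M − √(9M² − 8Q²))/2 and P₂ = (3M + √(9M² − 8Q²))/2. -/
/-- Under (GC), `9M² - 8Q² > 0`; equivalently `M > (2√2/3)|Q|`, so the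
quadratic `S(r) = -r² + 3Mr - 2Q²` has two distinct positive roots `P₁ < P₂`. -/
theorem stmt_19 (M Q Λ : ℝ) (hM : 0 < M) (hΛ : 0 < Λ) (hQ : Q ≠ 0)
    (R Δ m₁ m₂ M₁ M₂ : ℝ)
    (hR : R = 1 / Real.sqrt (6 * Λ))
    (hΔ : Δ = 1 - 12 * Q ^ 2 * Λ)
    (hm₁ : m₁ = R * Real.sqrt (1 - Real.sqrt Δ))
    (hm₂ : m₂ = R * Real.sqrt (1 + Real.sqrt Δ))
    (hM₁ : M₁ = m₁ - 2 * Λ * m₁ ^ 3)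
    (hM₂ : M₂ = m₂ - 2 * Λ * m₂ ^ 3)
    (hGC : Q ≠ 0 ∧ 0 < Λ ∧ Λ < 1 / (12 * Q ^ 2) ∧ M₁ < M ∧ M < M₂)
    (P₁ P₂ : ℝ)
    (hP₁ : P₁ = (3 * M - Real.sqrt (9 * M ^ 2 - 8 * Q ^ 2)) / 2)
    (hP₂ : P₂ = (3 * M + Real.sqrt (9 * M ^ 2 - 8 * Q ^ 2)) / 2) :
    9 * M ^ 2 - 8 * Q ^ 2 > 0 ∧
    M > (2 * Real.sqrt 2 / 3) * |Q| ∧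
    0 < P₁ ∧ P₁ < P₂ ∧
    {r : ℝ | -r ^ 2 + 3 * M * r - 2 * Q ^ 2 = 0} = {P₁, P₂} := by
  obtain ⟨-, -, hL, h1, -⟩ := hGC
  have hQ2 : 0 < Q ^ 2 := by positivity
  have hΔ0 : 0 < Δ := by
    rw [lt_div_iff₀ (by positivity)] at hL
    rw [hΔ]; nlinarith
  have hd0 : 0 < Real.sqrt Δ := Real.sqrt_pos.mpr hΔ0
  have hd2 : Real.sqrt Δ ^ 2 = Δ := Real.sq_sqrt hΔ0.le
  generalize Real.sqrt Δ = d at *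
  have hQL : 0 < Q ^ 2 * Λ := by positivity
  have hd1 : d < 1 := by nlinarith
  have hR2 : R ^ 2 * (6 * Λ) = 1 := by
    rw [hR, div_pow, Real.sq_sqrt (by positivity)]
    field_simp
  have hR0 : 0 < R := by rw [hR]; positivity
  have hm0 : 0 ≤ m₁ := by rw [hm₁]; positivity
  have hm2 : m₁ ^ 2 * (6 * Λ) = 1 - d := by
    rw [hm₁, mul_pow, Real.sq_sqrt (by linarith)]
    linear_combination (1 - d) * hR2
  have hM1 : M₁ = m₁ * (2 + d) / 3 := by
    rw [hM₁]; linear_combination (-m₁ / 3) * hm2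
  have hM10 : 0 ≤ M₁ := by rw [hM1]; positivity
  have hMM : M₁ ^ 2 < M ^ 2 := by nlinarith
  have hQe : 8 * Q ^ 2 = 4 * m₁ ^ 2 * (1 + d) := by
    have : (8 * Q ^ 2) * (6 * Λ) = (4 * m₁ ^ 2 * (1 + d)) * (6 * Λ) := by
      linear_combination (4 : ℝ) * hΔ - 4 * (1 + d) * hm2 + 4 * hd2
    exact mul_right_cancel₀ (by positivity) this
  have hK : 9 * M₁ ^ 2 - 8 * Q ^ 2 = (m₁ * d) ^ 2 := by
    rw [hQe, hM1]; ring
  have hpos : 0 < 9 * M ^ 2 - 8 * Q ^ 2 := by nlinarith [sq_nonneg (m₁ * d)]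
  have hs0 := Real.sqrt_pos.mpr hpos
  have hs2 := Real.sq_sqrt hpos.le
  generalize Real.sqrt (9 * M ^ 2 - 8 * Q ^ 2) = s at *
  refine ⟨hpos, ?_, ?_, ?_, ?_⟩
  · apply lt_of_pow_lt_pow_left₀ 2 hM.le
    rw [mul_pow, div_pow, mul_pow, Real.sq_sqrt (by norm_num), sq_abs]
    linarith
  · have : s < 3 * M := by
      apply lt_of_pow_lt_pow_left₀ 2 (by positivity)
      nlinarith
    rw [hP₁]; linarith
  · rw [hP₁, hP₂]; linarith
  · ext r
    have hf : -r ^ 2 + 3 * M * r - 2 * Q ^ 2 = -((r - P₁) * (r - P₂)) := by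
      rw [hP₁, hP₂]; linear_combination (-1 / 4 : ℝ) * hs2
    simp only [Set.mem_ofPred_eq, Set.mem_insert_iff, Set.mem_singleton_iff]
    rw [hf, neg_eq_zero, mul_eq_zero, sub_eq_zero, sub_eq_zero]
end
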